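/- Under the framework assumptions on the structure of the system and on the data, the component y of the solution is uniquely determined: if (y₁,μ₁) and (y₂,μ₂) are two pairs satisfying the regularity requirements and solving the fractional Cahn–Hilliard system with the same data u and y₀, then y₁ = y₂. -/

import Mathlib

noncomputable section

open MeasureTheory Filter Topology RealInnerProductSpace Set ENNReal NNReal

namespace FracCH

/-- The ambient space `ℝ³`. -/
abbrev E3 := EuclideanSpace ℝ (Fin 3)

/-- Lebesgue measure restricted to `Om`. -/
abbrev mOm (Om : Set E3) : Measure E3 := volume.restrict Om

/-- The Hilbert space `H = L²(Om)`. -/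
abbrev Hs (Om : Set E3) := MeasureTheory.Lp ℝ 2 (mOm Om)

/-- The fractional power (in the spectral sense) with exponent `ρ` of the operator whose
eigenvalues are `lam` and whose orthonormal eigenvectors are `e`. -/
def fracPow {Om : Set E3} (lam : ℕ → ℝ) (e : ℕ → Hs Om) (ρ : ℝ) (v : Hs Om) : Hs Om :=
  ∑' j, ((lam j) ^ ρ * ⟪v, e j⟫) • e j

/-- Membership in the domain of the fractional power of exponent `ρ`. -/
def inDom {Om : Set E3} (lam : ℕ → ℝ) (e : ℕ → Hs Om) (ρ : ℝ) (v : Hs Om) : Prop :=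
  Summable fun j => ((lam j) ^ ρ * ⟪v, e j⟫) ^ 2

/-- Mean value of `v` on `Om`. -/
def meanVal {Om : Set E3} (v : Hs Om) : ℝ := (∫ x, v x ∂(mOm Om)) / (volume Om).toReal

/-- Subdifferential of a convex function `b : ℝ → [0,+∞]`. -/
def subdiff (b : ℝ → ℝ≥0∞) (s : ℝ) : Set ℝ :=
  {ξ | b s < ⊤ ∧ ∀ t : ℝ, ENNReal.ofReal ((b s).toReal + ξ * (t - s)) ≤ b t}

/-- Square of the graph norm of the domain of a fractional power. -/
def gnormSq {Om : Set E3} (lam : ℕ → ℝ) (e : ℕ → Hs Om) (ρ : ℝ) (v : Hs Om) : ℝ :=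
  ‖v‖ ^ 2 + ‖fracPow lam e ρ v‖ ^ 2

/-- Square of the dual norm (the norm of `V_A^{-r}`) of a linear functional. -/
def dualNormSq {Om : Set E3} (lam : ℕ → ℝ) (e : ℕ → Hs Om) (ρ : ℝ)
    (f : Hs Om →ₗ[ℝ] ℝ) : ℝ :=
  sSup {a : ℝ | ∃ v : Hs Om, inDom lam e ρ v ∧ gnormSq lam e ρ v ≤ 1 ∧ a = (f v) ^ 2}

/-- The inner product of the Hilbert space which is the domain of a fractional power
(e.g.`V_B^σ`). -/
def innerFrac {Om : Set E3} (lam : ℕ → ℝ) (e : ℕ → Hs Om) (ρ : ℝ) (a b : Hs Om) : ℝ :=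
  ⟪a, b⟫ + ⟪fracPow lam e ρ a, fracPow lam e ρ b⟫

/-- The structural assumptions: `Om ⊂ ℝ³` is open, connected and bounded; `A` and `B` are
unbounded monotone selfadjoint operators with compact resolvents, described by their
nondecreasing sequences of eigenvalues `lamA`, `lamB` (tending to `+∞`) and complete
orthonormal systems of eigenvectors `eA`, `eB`; `r, σ > 0`, `τ ∈ [0,1]`; either `λ₁ > 0`
or `0 = λ₁ < λ₂` with `e₁` constant; if `λ₁ = 0` the constants belong to `V_B^σ`. -/
def SettingHyps (Om : Set E3) (lamA lamB : ℕ → ℝ) (eA eB : ℕ → Hs Om)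
    (r σ τ : ℝ) : Prop :=
  IsOpen Om ∧ IsConnected Om ∧ Bornology.IsBounded Om ∧
  (∀ j, 0 ≤ lamA j) ∧ (∀ j, 0 ≤ lamB j) ∧ Monotone lamA ∧ Monotone lamB ∧
  Tendsto lamA atTop atTop ∧ Tendsto lamB atTop atTop ∧
  Orthonormal ℝ eA ∧ Orthonormal ℝ eB ∧
  (Submodule.span ℝ (Set.range eA)).topologicalClosure = ⊤ ∧
  (Submodule.span ℝ (Set.range eB)).topologicalClosure = ⊤ ∧
  0 < r ∧ 0 < σ ∧ τ ∈ Set.Icc (0:ℝ) 1 ∧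
  (0 < lamA 0 ∨ (lamA 0 = 0 ∧ 0 < lamA 1 ∧ ∃ c : ℝ, ∀ᵐ x ∂(mOm Om), eA 0 x = c)) ∧
  (lamA 0 = 0 → ∀ c : ℝ, ∃ w : Hs Om, inDom lamB eB σ w ∧ (∀ᵐ x ∂(mOm Om), w x = c))

/-- The assumptions on the nonlinearity `f = β̂ + π̂` and on the data `u`, `y₀`:
`β̂ : ℝ → [0,+∞]` is convex, l.s.c., with `β̂(0) = 0`; `π̂` is `C¹` with Lipschitz
continuous derivative `π`; the coercivity `liminf_{|s|→∞}(β̂(s)+π̂(s))/s² > 0` holds;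
`u ∈ W^{1,1}_loc([0,∞);H)` with primitive representation by `u'` and `∂_t u ∈ L¹(0,∞;H)`;
`y₀ ∈ V_B^σ` with `β̂(y₀) ∈ L¹(Om)`; and if `λ₁ = 0` the mean of `y₀` lies in the
interior of `D(β)`. -/
def DataHyps (Om : Set E3) (lamA lamB : ℕ → ℝ) (eB : ℕ → Hs Om) (σ : ℝ)
    (betah : ℝ → ℝ≥0∞) (pih piF : ℝ → ℝ) (Lpi : ℝ≥0)
    (u u' : ℝ → Hs Om) (y0 : Hs Om) : Prop :=
  (∀ a b t : ℝ, 0 ≤ t → t ≤ 1 →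
    betah (t * a + (1 - t) * b) ≤ ENNReal.ofReal t * betah a + ENNReal.ofReal (1 - t) * betah b) ∧
  LowerSemicontinuous betah ∧ betah 0 = 0 ∧
  (∀ s, HasDerivAt pih (piF s) s) ∧ LipschitzWith Lpi piF ∧
  (∃ α : ℝ, 0 < α ∧ ∀ᶠ s : ℝ in Filter.comap (|·|) atTop,
    ENNReal.ofReal (α * s ^ 2 - pih s) ≤ betah s) ∧
  IntegrableOn u' (Set.Ioi (0:ℝ)) ∧
  (∀ t : ℝ, 0 ≤ t → u t = u 0 + ∫ s in (0:ℝ)..t, u' s) ∧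
  inDom lamB eB σ y0 ∧ (∫⁻ x, betah (y0 x) ∂(mOm Om)) < ⊤ ∧
  (lamA 0 = 0 → meanVal y0 ∈ interior {s : ℝ | (subdiff betah s).Nonempty})

/-- The notion of solution `(y, μ)` of the weak formulation of the fractional
Cahn--Hilliard system on the half line `t ≥ 0`.  Here `dy t ∈ V_A^{-r}` represents the
time derivative `∂_t y(t)` (acting on test functions, and linked to `y` by the integral
identity `(y(t),v) = (y(0),v) + ∫_0^t ⟨∂_t y(s),v⟩ ds`), while `z` represents
`τ ∂_t y ∈ L²(0,T;H)`.  The requirements are the regularity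
`y ∈ L^∞(0,T;V_B^σ)`, `∂_t y ∈ L²(0,T;V_A^{-r})`, `τ ∂_t y ∈ L²(0,T;H)`,
`μ ∈ L²(0,T;V_A^r)`, `β̂(y) ∈ L¹(Om×(0,T))` for every `T > 0`, the two variational
equations/inequalities for a.a. `t`, and the initial condition `y(0) = y₀`. -/
def IsSolution (Om : Set E3) (lamA lamB : ℕ → ℝ) (eA eB : ℕ → Hs Om) (r σ τ : ℝ)
    (betah : ℝ → ℝ≥0∞) (piF : ℝ → ℝ) (u : ℝ → Hs Om) (y0 : Hs Om)
    (y μ : ℝ → Hs Om) (dy : ℝ → Hs Om →ₗ[ℝ] ℝ) (z : ℝ → Hs Om) : Prop :=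
  AEStronglyMeasurable y (volume.restrict (Set.Ioi (0:ℝ))) ∧
  (∀ᵐ t ∂(volume.restrict (Set.Ioi (0:ℝ))), inDom lamB eB σ (y t)) ∧
  (∀ T : ℝ, 0 < T → ∃ C : ℝ,
    ∀ᵐ t ∂(volume.restrict (Set.Ioc (0:ℝ) T)), gnormSq lamB eB σ (y t) ≤ C) ∧
  (∀ v : Hs Om, inDom lamA eA r v → ∀ T : ℝ, 0 < T →
    IntegrableOn (fun s => dy s v) (Set.Ioc (0:ℝ) T)) ∧
  (∀ v : Hs Om, inDom lamA eA r v → ∀ t : ℝ, 0 ≤ t →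
    ⟪y t, v⟫ = ⟪y 0, v⟫ + ∫ s in (0:ℝ)..t, dy s v) ∧
  (∀ T : ℝ, 0 < T → IntegrableOn (fun t => dualNormSq lamA eA r (dy t)) (Set.Ioc (0:ℝ) T)) ∧
  AEStronglyMeasurable z (volume.restrict (Set.Ioi (0:ℝ))) ∧
  (∀ᵐ t ∂(volume.restrict (Set.Ioi (0:ℝ))), ∀ v : Hs Om, inDom lamA eA r v →
    ⟪z t, v⟫ = τ * dy t v) ∧
  (∀ T : ℝ, 0 < T → IntegrableOn (fun t => ‖z t‖ ^ 2) (Set.Ioc (0:ℝ) T)) ∧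
  AEStronglyMeasurable μ (volume.restrict (Set.Ioi (0:ℝ))) ∧
  (∀ᵐ t ∂(volume.restrict (Set.Ioi (0:ℝ))), inDom lamA eA r (μ t)) ∧
  (∀ T : ℝ, 0 < T → IntegrableOn (fun t => gnormSq lamA eA r (μ t)) (Set.Ioc (0:ℝ) T)) ∧
  (∀ T : ℝ, 0 < T → (∫⁻ t in Set.Ioc (0:ℝ) T, ∫⁻ x, betah (y t x) ∂(mOm Om)) < ⊤) ∧
  (∀ᵐ t ∂(volume.restrict (Set.Ioi (0:ℝ))), ∀ v : Hs Om, inDom lamA eA r v →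
    dy t v + ⟪fracPow lamA eA r (μ t), fracPow lamA eA r v⟫ = 0) ∧
  (∀ᵐ t ∂(volume.restrict (Set.Ioi (0:ℝ))), ∀ v : Hs Om,
    inDom lamB eB σ v → (∫⁻ x, betah (v x) ∂(mOm Om)) < ⊤ →
    ⟪z t, y t - v⟫
      + ⟪fracPow lamB eB σ (y t), fracPow lamB eB σ (y t) - fracPow lamB eB σ v⟫
      + (∫⁻ x, betah (y t x) ∂(mOm Om)).toReal
      + ∫ x, (piF (y t x) - u t x) * (y t x - v x) ∂(mOm Om)
      ≤ ⟪μ t, y t - v⟫ + (∫⁻ x, betah (v x) ∂(mOm Om)).toReal) ∧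
  y 0 = y0

/-- The ω-limit set of the trajectory `y`, in the weak topology of `V_B^σ`. -/
def omegaLimit {Om : Set E3} (lamB : ℕ → ℝ) (eB : ℕ → Hs Om) (σ : ℝ)
    (y : ℝ → Hs Om) : Set (Hs Om) :=
  {w | inDom lamB eB σ w ∧ ∃ tn : ℕ → ℝ, StrictMono tn ∧ (∀ n, 0 ≤ tn n) ∧
    Tendsto tn atTop atTop ∧
    ∀ φ : Hs Om, inDom lamB eB σ φ →
      Tendsto (fun n => innerFrac lamB eB σ (y (tn n)) φ) atTop
        (nhds (innerFrac lamB eB σ w φ))}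

theorem integral_mul_primitive {f : ℝ → ℝ} {t : ℝ} (hf : IntervalIntegrable f volume 0 t) :
    ∫ s in (0:ℝ)..t, f s * ∫ x in (0:ℝ)..s, f x = (∫ s in (0:ℝ)..t, f s) ^ 2 / 2 := by
  have hac := hf.absolutelyContinuousOnInterval_intervalIntegral (c := 0) (by simp)
  have hd := hac.integral_deriv_mul_eq_sub hac
  have hcongr : ∫ s in (0:ℝ)..t, 2 * (f s * ∫ x in (0:ℝ)..s, f x) =
      ∫ s in (0:ℝ)..t, (deriv (fun s => ∫ x in (0:ℝ)..s, f x) s * (∫ x in (0:ℝ)..s, f x) +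
        (∫ x in (0:ℝ)..s, f x) * deriv (fun s => ∫ x in (0:ℝ)..s, f x) s) := by
    apply intervalIntegral.integral_congr_ae
    filter_upwards [hf.ae_hasDerivAt_integral] with s hs hst
    rw [(hs (uIoc_subset_uIcc hst) 0 (by simp)).deriv]
    ring
  rw [hd, intervalIntegral.integral_const_mul] at hcongr
  simp only [intervalIntegral.integral_same] at hcongr
  linarith

theorem eq_zero_of_primitive_le {φ g : ℝ → ℝ} {K T : ℝ}
    (hg : IntegrableOn g (Ioc 0 T)) (hφ : ∀ t ∈ Icc 0 T, φ t = ∫ s in Ioc 0 t, g s)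
    (hφ0 : ∀ t ∈ Icc 0 T, 0 ≤ φ t)
    (hle : ∀ᵐ t ∂volume.restrict (Ioc 0 T), g t ≤ K * φ t) :
    ∀ t ∈ Ico 0 T, φ t = 0 := by
  set gi : ℝ → ℝ := (Ioc 0 T).indicator g with hgi
  have hgint : Integrable gi := hg.integrable_indicator measurableSet_Ioc
  set p : ℝ → ℝ := fun t => ∫ s in (0:ℝ)..t, gi s with hp
  have hpc : Continuous p := hgint.continuous_primitive 0
  have hpφ : ∀ t ∈ Icc 0 T, p t = φ t := by
    intro t ht
    rw [hφ t ht, hp]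
    simp only
    rw [intervalIntegral.integral_of_le ht.1]
    refine setIntegral_congr_fun measurableSet_Ioc fun s hs => ?_
    exact indicator_of_mem (show s ∈ Ioc 0 T from ⟨hs.1, hs.2.trans ht.2⟩) g
  have hP : ∀ t, HasDerivAt (fun t => ∫ s in (0:ℝ)..t, p s) (p t) t := fun t =>
    (hpc.integral_hasStrictDerivAt 0 t).hasDerivAt
  have hpP : ∀ t ∈ Icc 0 T, p t ≤ K * ∫ s in (0:ℝ)..t, p s := by
    intro t ht
    rw [← intervalIntegral.integral_const_mul, hpφ t ht, hφ t ht,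
      intervalIntegral.integral_of_le ht.1]
    refine setIntegral_mono_ae_restrict (hg.mono_set (Ioc_subset_Ioc_right ht.2))
      ((hpc.integrableOn_Icc.mono_set Ioc_subset_Icc_self).const_mul K) ?_
    filter_upwards [ae_restrict_of_ae_restrict_of_subset (Ioc_subset_Ioc_right ht.2) hle,
      ae_restrict_mem measurableSet_Ioc] with s hs hst
    rw [hpφ s ⟨hst.1.le, hst.2.trans ht.2⟩]
    exact hs
  have hP0 : ∀ t ∈ Icc 0 T, 0 ≤ ∫ s in (0:ℝ)..t, p s := fun t ht =>
    intervalIntegral.integral_nonneg ht.1 fun s hs => by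
      rw [hpφ s ⟨hs.1, hs.2.trans ht.2⟩]
      exact hφ0 s ⟨hs.1, hs.2.trans ht.2⟩
  intro t ht
  have hgron := norm_le_gronwallBound_of_norm_deriv_right_le (δ := 0) (K := K) (ε := 0)
    (a := 0) (b := T) (f := fun t => ∫ s in (0:ℝ)..t, p s) (f' := p)
    (fun t _ => (hP t).continuousAt.continuousWithinAt)
    (fun t _ => (hP t).hasDerivWithinAt) (by simp) (fun x hx => by
      have hx' := Ico_subset_Icc_self hx
      rw [Real.norm_of_nonneg (hP0 x hx'), Real.norm_of_nonneg
        ((hpφ x hx').symm ▸ hφ0 x hx'), add_zero]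
      exact hpP x hx') t (Ico_subset_Icc_self ht)
  have hz : ∫ s in (0:ℝ)..t, p s = 0 := by simpa [gronwallBound_ε0_δ0] using hgron
  have ht' := Ico_subset_Icc_self ht
  have := hpP t ht'
  rw [hz, mul_zero, hpφ t ht'] at this
  exact le_antisymm this (hφ0 t ht')

section Hilbert

variable {H : Type*} [NormedAddCommGroup H] [InnerProductSpace ℝ H]

theorem hasSum_sq_inner (b : HilbertBasis ℕ ℝ H) (x : H) :
    HasSum (fun j => ⟪x, b j⟫ ^ 2) (‖x‖ ^ 2) := by
  have := b.hasSum_inner_mul_inner x x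
  rw [real_inner_self_eq_norm_sq] at this
  refine this.congr_fun fun j => ?_
  rw [real_inner_comm x (b j), sq]

theorem exists_sq_inner_le (a : HilbertBasis ℕ ℝ H) {w : ℕ → ℝ} (hw : ∀ j, 0 < w j) (x : H)
    {δ : ℝ} (hδ : 0 < δ) :
    ∃ C, 0 ≤ C ∧ ∀ (y : H) (φ : ℝ), HasSum (fun j => w j * ⟪y, a j⟫ ^ 2) φ →
      ⟪y, x⟫ ^ 2 ≤ δ * ‖y‖ ^ 2 + C * φ := by
  obtain ⟨s, hs⟩ : ∃ s : Finset ℕ, ‖∑ j ∈ s, a.repr x j • a j - x‖ < √(δ / 2) := by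
    have := (a.hasSum_repr x).eventually (Metric.ball_mem_nhds x (Real.sqrt_pos.2 (half_pos hδ)))
    obtain ⟨s, hs⟩ := this.exists
    exact ⟨s, by simpa [dist_eq_norm] using hs⟩
  refine ⟨2 * ∑ j ∈ s, (a.repr x j) ^ 2 / w j,
    mul_nonneg zero_le_two (Finset.sum_nonneg fun j _ => div_nonneg (sq_nonneg _) (hw j).le), ?_⟩
  intro y φ hφ
  have h1 : ⟪y, ∑ j ∈ s, a.repr x j • a j - x⟫ ^ 2 ≤ δ / 2 * ‖y‖ ^ 2 := by
    have hcs := abs_real_inner_le_norm y (∑ j ∈ s, a.repr x j • a j - x)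
    have hn : ‖∑ j ∈ s, a.repr x j • a j - x‖ ^ 2 ≤ δ / 2 :=
      (Real.le_sqrt (norm_nonneg _) (half_pos hδ).le).1 hs.le
    calc _ = |⟪y, ∑ j ∈ s, a.repr x j • a j - x⟫| ^ 2 := (sq_abs _).symm
      _ ≤ (‖y‖ * ‖∑ j ∈ s, a.repr x j • a j - x‖) ^ 2 := by gcongr
      _ = ‖∑ j ∈ s, a.repr x j • a j - x‖ ^ 2 * ‖y‖ ^ 2 := by ring
      _ ≤ _ := by gcongr
  have h2 : ⟪y, ∑ j ∈ s, a.repr x j • a j⟫ ^ 2 ≤ (∑ j ∈ s, (a.repr x j) ^ 2 / w j) * φ := by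
    calc _ = (∑ j ∈ s, a.repr x j * ⟪y, a j⟫) ^ 2 := by
          simp [inner_sum, real_inner_smul_right]
      _ ≤ (∑ j ∈ s, (a.repr x j) ^ 2 / w j) * ∑ j ∈ s, w j * ⟪y, a j⟫ ^ 2 := by
          refine Finset.sum_sq_le_sum_mul_sum_of_sq_le_mul s
            (fun j _ => div_nonneg (sq_nonneg _) (hw j).le)
            (fun j _ => mul_nonneg (hw j).le (sq_nonneg _)) fun j _ => le_of_eq ?_
          have := (hw j).ne'
          field_simp
      _ ≤ _ := by
          gcongr
          · exact Finset.sum_nonneg fun j _ => div_nonneg (sq_nonneg _) (hw j).le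
          · exact sum_le_hasSum s (fun j _ => mul_nonneg (hw j).le (sq_nonneg _)) hφ
  have h3 : ⟪y, x⟫ = ⟪y, ∑ j ∈ s, a.repr x j • a j⟫
      - ⟪y, ∑ j ∈ s, a.repr x j • a j - x⟫ := by
    rw [inner_sub_right]; ring
  rw [h3]
  nlinarith [sq_nonneg (⟪y, ∑ j ∈ s, a.repr x j • a j⟫
      + ⟪y, ∑ j ∈ s, a.repr x j • a j - x⟫)]

theorem exists_norm_sq_le (a b : HilbertBasis ℕ ℝ H) {w κ : ℕ → ℝ} (hw : ∀ j, 0 < w j)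
    (hκ : Tendsto κ atTop atTop) {ε : ℝ} (hε : 0 < ε) :
    ∃ C, ∀ (y : H) (φ β : ℝ), HasSum (fun j => w j * ⟪y, a j⟫ ^ 2) φ →
      HasSum (fun k => (κ k * ⟪y, b k⟫) ^ 2) β → ‖y‖ ^ 2 ≤ ε * β + C * φ := by
  obtain ⟨N, hN⟩ : ∃ N, ∀ k ≥ N, 2 / ε ≤ κ k ^ 2 :=
    eventually_atTop.1 (((tendsto_pow_atTop two_ne_zero).comp hκ).eventually_ge_atTop (2 / ε))
  have hδ : (0:ℝ) < 1 / (2 * (N + 1)) := by positivity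
  choose C hC0 hC using fun k => exists_sq_inner_le a hw (b k) hδ
  refine ⟨2 * ∑ k ∈ Finset.range N, C k, fun y φ β hφ hβ => ?_⟩
  have hfin : HasSum (fun k => if k ∈ Finset.range N then ⟪y, b k⟫ ^ 2 else 0)
      (∑ k ∈ Finset.range N, ⟪y, b k⟫ ^ 2) := by
    rw [← Finset.sum_congr rfl fun k hk => if_pos hk]
    exact hasSum_sum_of_ne_finset_zero fun k hk => if_neg hk
  have h1 : ‖y‖ ^ 2 ≤ ε / 2 * β + ∑ k ∈ Finset.range N, ⟪y, b k⟫ ^ 2 := by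
    refine hasSum_le (fun k => ?_) (hasSum_sq_inner b y) ((hβ.mul_left (ε / 2)).add hfin)
    split_ifs with hk
    · have : 0 ≤ ε / 2 * (κ k * ⟪y, b k⟫) ^ 2 := by positivity
      linarith
    · have hk' := hN k (by simpa using hk)
      rw [div_le_iff₀ hε] at hk'
      rw [mul_pow, add_zero, ← mul_assoc]
      exact le_mul_of_one_le_left (sq_nonneg _) (by linarith)
  have h2 : ∑ k ∈ Finset.range N, ⟪y, b k⟫ ^ 2 ≤
      1 / 2 * ‖y‖ ^ 2 + (∑ k ∈ Finset.range N, C k) * φ := by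
    calc _ ≤ ∑ k ∈ Finset.range N, (1 / (2 * ((N:ℝ) + 1)) * ‖y‖ ^ 2 + C k * φ) :=
          Finset.sum_le_sum fun k _ => hC k y φ hφ
      _ = N * (1 / (2 * ((N:ℝ) + 1))) * ‖y‖ ^ 2 + (∑ k ∈ Finset.range N, C k) * φ := by
          rw [Finset.sum_add_distrib, Finset.sum_mul]; simp [mul_assoc]
      _ ≤ _ := by
          gcongr
          rw [mul_one_div, div_le_div_iff₀ (by positivity) two_pos]
          linarith
  linarith

theorem hasSum_setIntegral_inner (a : HilbertBasis ℕ ℝ H) {g y : ℝ → H} {f : ℕ → ℝ → ℝ}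
    {w : ℕ → ℝ} {t : ℝ} (ht : 0 ≤ t)
    (hgm : AEStronglyMeasurable g (volume.restrict (Ioc 0 t)))
    (hym : AEStronglyMeasurable y (volume.restrict (Ioc 0 t)))
    (hg : IntegrableOn (fun s => ‖g s‖ ^ 2) (Ioc 0 t))
    (hy : IntegrableOn (fun s => ‖y s‖ ^ 2) (Ioc 0 t))
    (hf : ∀ j, IntegrableOn (f j) (Ioc 0 t))
    (hyf : ∀ j, ∀ s ∈ Icc 0 t, ⟪y s, a j⟫ = ∫ x in (0:ℝ)..s, f j x)
    (hgf : ∀ j, ∀ᵐ s ∂volume.restrict (Ioc 0 t),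
      ⟪g s, a j⟫ * ⟪y s, a j⟫ = w j * (f j s * ⟪y s, a j⟫)) :
    HasSum (fun j => w j * ⟪y t, a j⟫ ^ 2 / 2) (∫ s in Ioc 0 t, ⟪g s, y s⟫) := by
  have hlim : ∀ s, HasSum (fun j => ⟪g s, a j⟫ * ⟪y s, a j⟫) ⟪g s, y s⟫ := fun s => by
    refine (a.hasSum_inner_mul_inner (g s) (y s)).congr_fun fun j => ?_
    rw [real_inner_comm (y s)]
  have hbd : ∀ s, HasSum (fun j => (⟪g s, a j⟫ ^ 2 + ⟪y s, a j⟫ ^ 2) / 2)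
      ((‖g s‖ ^ 2 + ‖y s‖ ^ 2) / 2) := fun s =>
    ((hasSum_sq_inner a (g s)).add (hasSum_sq_inner a (y s))).div_const 2
  have key := hasSum_integral_of_dominated_convergence
    (μ := volume.restrict (Ioc 0 t)) (F := fun j s => ⟪g s, a j⟫ * ⟪y s, a j⟫)
    (f := fun s => ⟪g s, y s⟫)
    (fun j s => (⟪g s, a j⟫ ^ 2 + ⟪y s, a j⟫ ^ 2) / 2)
    (fun j => (hgm.inner aestronglyMeasurable_const).mul (hym.inner aestronglyMeasurable_const))
    (fun j => Eventually.of_forall fun s => by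
      rw [Real.norm_eq_abs, abs_le]
      constructor <;> nlinarith [sq_nonneg (⟪g s, a j⟫ + ⟪y s, a j⟫),
        sq_nonneg (⟪g s, a j⟫ - ⟪y s, a j⟫)])
    (Eventually.of_forall fun s => (hbd s).summable)
    (by
      simp_rw [fun s => (hbd s).tsum_eq]
      exact (hg.add hy).div_const 2)
    (Eventually.of_forall hlim)
  refine key.congr_fun fun j => ?_
  have hfi : IntervalIntegrable (f j) volume 0 t :=
    (intervalIntegrable_iff_integrableOn_Ioc_of_le ht).2 (hf j)
  rw [integral_congr_ae (hgf j), integral_const_mul, hyf j t ⟨ht, le_rfl⟩, mul_div_assoc,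
    ← integral_mul_primitive hfi, intervalIntegral.integral_of_le ht]
  congr 1
  refine setIntegral_congr_fun measurableSet_Ioc fun s hs => ?_
  rw [hyf j s (Ioc_subset_Icc_self hs)]

end Hilbert
theorem inner_fracPow {Om : Set E3} {lam : ℕ → ℝ} (b : HilbertBasis ℕ ℝ (Hs Om)) {ρ : ℝ}
    {v : Hs Om} (hv : inDom lam b ρ v) (k : ℕ) :
    ⟪fracPow lam b ρ v, b k⟫ = lam k ^ ρ * ⟪v, b k⟫ := by
  have hmem : Memℓp (fun j => lam j ^ ρ * ⟪v, b j⟫) 2 := by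
    rw [memℓp_gen_iff (by simp)]
    simpa [inDom, mul_pow] using hv
  have hsum := (b.hasSum_repr_symm ⟨_, hmem⟩).tsum_eq
  have hfp : fracPow lam b ρ v = b.repr.symm ⟨_, hmem⟩ := hsum
  rw [hfp, real_inner_comm, ← b.repr_apply_apply, LinearIsometryEquiv.apply_symm_apply]

theorem inDom_basis {Om : Set E3} (lam : ℕ → ℝ) (b : HilbertBasis ℕ ℝ (Hs Om)) (ρ : ℝ) (k : ℕ) :
    inDom lam b ρ (b k) := by
  refine summable_of_ne_finset_zero (s := {k}) fun j hj => ?_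
  rw [b.orthonormal.inner_eq_zero (Ne.symm (by simpa using hj))]
  simp

theorem fracPow_basis {Om : Set E3} (lam : ℕ → ℝ) (b : HilbertBasis ℕ ℝ (Hs Om)) (ρ : ℝ) (k : ℕ) :
    fracPow lam b ρ (b k) = lam k ^ ρ • b k := by
  rw [fracPow, tsum_eq_single k fun j hj => ?_]
  · rw [real_inner_self_eq_norm_sq, b.orthonormal.norm_eq_one]
    simp
  · rw [b.orthonormal.inner_eq_zero hj.symm]
    simp

theorem lowerSemicontinuous_lintegral_comp {Om : Set E3} {betah : ℝ → ℝ≥0∞}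
    (hb : LowerSemicontinuous betah) :
    LowerSemicontinuous fun v : Hs Om => ∫⁻ x, betah (v x) ∂(mOm Om) := by
  rw [lowerSemicontinuous_iff_isClosed_preimage]
  intro c
  refine IsSeqClosed.isClosed fun v v₀ hv hlim => ?_
  obtain ⟨ns, -, hns⟩ := (tendstoInMeasure_of_tendsto_Lp hlim).exists_seq_tendsto_ae
  calc ∫⁻ x, betah (v₀ x) ∂(mOm Om)
      ≤ ∫⁻ x, liminf (fun n => betah (v (ns n) x)) atTop ∂(mOm Om) := by
        refine lintegral_mono_ae ?_
        filter_upwards [hns] with x hx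
        exact (hb.le_liminf (v₀ x)).trans hx.liminf_le_liminf_comp
    _ ≤ liminf (fun n => ∫⁻ x, betah (v (ns n) x) ∂(mOm Om)) atTop :=
        lintegral_liminf_le' fun n => hb.measurable.comp_aemeasurable
          (Lp.aestronglyMeasurable (v (ns n))).aemeasurable
    _ ≤ c := liminf_le_of_frequently_le' (Eventually.of_forall fun n => hv (ns n)).frequently

theorem ae_lintegral_comp_lt_top {Om : Set E3} {betah : ℝ → ℝ≥0∞}
    (hb : LowerSemicontinuous betah) {y : ℝ → Hs Om} {ν : Measure ℝ}
    (hy : AEStronglyMeasurable y ν)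
    (hfin : (∫⁻ t, ∫⁻ x, betah (y t x) ∂(mOm Om) ∂ν) < ⊤) :
    ∀ᵐ t ∂ν, (∫⁻ x, betah (y t x) ∂(mOm Om)) < ⊤ := by
  borelize (↥(Hs Om))
  exact ae_lt_top' ((lowerSemicontinuous_lintegral_comp hb).measurable.comp_aemeasurable
    hy.aemeasurable) hfin.ne

theorem memLp_comp_lipschitz {Om : Set E3} [IsFiniteMeasure (mOm Om)] {p : ℝ → ℝ} {L : ℝ≥0}
    (hp : LipschitzWith L p) (v : Hs Om) : MemLp (fun x => p (v x)) 2 (mOm Om) := by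
  have h0 : MemLp (fun x => p (v x) - p 0) 2 (mOm Om) := by
    refine (Lp.memLp v).of_le_mul (c := L) ?_ (Eventually.of_forall fun x => ?_)
    · exact (hp.continuous.comp_aestronglyMeasurable (Lp.aestronglyMeasurable v)).sub
        aestronglyMeasurable_const
    · simpa [dist_eq_norm] using hp.dist_le_mul (v x) 0
  exact (h0.add (memLp_const (p 0))).ae_eq (Eventually.of_forall fun x => by simp)

theorem neg_mul_norm_sq_le {Om : Set E3} [IsFiniteMeasure (mOm Om)] {p : ℝ → ℝ} {L : ℝ≥0}
    (hp : LipschitzWith L p) (v w f : Hs Om) :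
    -(L * ‖v - w‖ ^ 2) ≤ ∫ x, (p (v x) - f x) * (v x - w x) ∂(mOm Om)
      + ∫ x, (p (w x) - f x) * (w x - v x) ∂(mOm Om) := by
  have hi : ∀ a b : Hs Om, Integrable (fun x => (p (a x) - f x) * (a x - b x)) (mOm Om) :=
    fun a b => ((memLp_comp_lipschitz hp a).sub (Lp.memLp f)).integrable_mul
      ((Lp.memLp a).sub (Lp.memLp b))
  have hn : ‖v - w‖ ^ 2 = ∫ x, (v x - w x) ^ 2 ∂(mOm Om) := by
    rw [← real_inner_self_eq_norm_sq, L2.inner_def]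
    refine integral_congr_ae ?_
    filter_upwards [Lp.coeFn_sub v w] with x hx
    rw [hx, Pi.sub_apply, sq]
    rfl
  have hsq : Integrable (fun x => (v x - w x) ^ 2) (mOm Om) :=
    ((Lp.memLp v).sub (Lp.memLp w)).integrable_sq
  rw [← integral_add (hi v w) (hi w v), hn, ← integral_const_mul, ← integral_neg]
  refine integral_mono (hsq.const_mul _).neg ((hi v w).add (hi w v)) fun x => ?_
  have hl : |p (v x) - p (w x)| ≤ L * |v x - w x| := by
    simpa [Real.dist_eq] using hp.dist_le_mul (v x) (w x)
  have hm := mul_le_mul_of_nonneg_right hl (abs_nonneg (v x - w x))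
  rw [← abs_mul, mul_assoc, ← sq, sq_abs] at hm
  have := (abs_le.1 hm).1
  linarith

theorem inner_add_norm_sq_le {Om : Set E3} [IsFiniteMeasure (mOm Om)] {p : ℝ → ℝ} {L : ℝ≥0}
    (hp : LipschitzWith L p) {y₁ y₂ z₁ z₂ μ₁ μ₂ β₁ β₂ f : Hs Om} {c₁ c₂ : ℝ}
    (h₁ : ⟪z₁, y₁ - y₂⟫ + ⟪β₁, β₁ - β₂⟫ + c₁ + ∫ x, (p (y₁ x) - f x) * (y₁ x - y₂ x) ∂(mOm Om)
      ≤ ⟪μ₁, y₁ - y₂⟫ + c₂)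
    (h₂ : ⟪z₂, y₂ - y₁⟫ + ⟪β₂, β₂ - β₁⟫ + c₂ + ∫ x, (p (y₂ x) - f x) * (y₂ x - y₁ x) ∂(mOm Om)
      ≤ ⟪μ₂, y₂ - y₁⟫ + c₁) :
    ⟪(z₁ - z₂) - (μ₁ - μ₂), y₁ - y₂⟫ + ‖β₁ - β₂‖ ^ 2 ≤ L * ‖y₁ - y₂‖ ^ 2 := by
  have h := neg_mul_norm_sq_le hp y₁ y₂ f
  rw [← real_inner_self_eq_norm_sq (β₁ - β₂)]
  rw [← neg_sub y₁ y₂, ← neg_sub β₁ β₂] at h₂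
  simp only [inner_neg_right] at h₂
  rw [inner_sub_left, inner_sub_left z₁, inner_sub_left μ₁, inner_sub_left β₁]
  linarith

section Weak

variable {Om : Set E3} {lamA lamB : ℕ → ℝ} {eA eB : ℕ → Hs Om} {r σ τ : ℝ}
  {betah : ℝ → ℝ≥0∞} {piF : ℝ → ℝ} {u : ℝ → Hs Om} {y0 : Hs Om}

theorem IsSolution.memLp_two {y μ : ℝ → Hs Om} {dy : ℝ → Hs Om →ₗ[ℝ] ℝ}
    {z : ℝ → Hs Om} (h : IsSolution Om lamA lamB eA eB r σ τ betah piF u y0 y μ dy z)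
    {T : ℝ} (hT : 0 < T) :
    MemLp y 2 (volume.restrict (Ioc 0 T)) ∧ MemLp z 2 (volume.restrict (Ioc 0 T)) ∧
      MemLp μ 2 (volume.restrict (Ioc 0 T)) := by
  obtain ⟨hym, -, hyb, -, -, -, hzm, -, hz, hμm, -, hμ, -⟩ := h
  have hsub : Ioc 0 T ⊆ Ioi (0:ℝ) := fun t ht => ht.1
  refine ⟨(memLp_two_iff_integrable_sq_norm (hym.mono_set hsub)).2 ?_,
    (memLp_two_iff_integrable_sq_norm (hzm.mono_set hsub)).2 (hz T hT),
    (memLp_two_iff_integrable_sq_norm (hμm.mono_set hsub)).2 ?_⟩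
  · obtain ⟨C, hC⟩ := hyb T hT
    refine Integrable.of_bound ((hym.mono_set hsub).norm.pow 2) C ?_
    filter_upwards [hC] with t ht
    rw [Real.norm_of_nonneg (sq_nonneg _)]
    exact (le_add_of_nonneg_right (sq_nonneg _)).trans ht
  · refine (hμ T hT).mono' ((hμm.mono_set hsub).norm.pow 2) (Eventually.of_forall fun t => ?_)
    rw [Real.norm_of_nonneg (sq_nonneg _)]
    exact le_add_of_nonneg_right (sq_nonneg _)

theorem IsSolution.ae_dual_apply {a : HilbertBasis ℕ ℝ (Hs Om)} {y μ : ℝ → Hs Om}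
    {dy : ℝ → Hs Om →ₗ[ℝ] ℝ} {z : ℝ → Hs Om}
    (h : IsSolution Om lamA lamB a eB r σ τ betah piF u y0 y μ dy z) :
    ∀ᵐ t ∂volume.restrict (Ioi (0:ℝ)), ∀ j,
      dy t (a j) = -((lamA j ^ r) ^ 2 * ⟪μ t, a j⟫) ∧ ⟪z t, a j⟫ = τ * dy t (a j) := by
  obtain ⟨-, -, -, -, -, -, -, hz, -, -, hμ, -, -, heq, -⟩ := h
  filter_upwards [hz, hμ, heq] with t hz hμ heq j
  refine ⟨?_, hz _ (inDom_basis lamA a r j)⟩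
  have := heq _ (inDom_basis lamA a r j)
  rw [fracPow_basis, real_inner_smul_right, inner_fracPow a hμ] at this
  linarith

theorem ae_inner_add_norm_sq_le [IsFiniteMeasure (mOm Om)] {Lpi : ℝ≥0}
    (hpi : LipschitzWith Lpi piF) (hb : LowerSemicontinuous betah)
    {y₁ μ₁ : ℝ → Hs Om} {dy₁ : ℝ → Hs Om →ₗ[ℝ] ℝ} {z₁ : ℝ → Hs Om}
    {y₂ μ₂ : ℝ → Hs Om} {dy₂ : ℝ → Hs Om →ₗ[ℝ] ℝ} {z₂ : ℝ → Hs Om}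
    (h₁ : IsSolution Om lamA lamB eA eB r σ τ betah piF u y0 y₁ μ₁ dy₁ z₁)
    (h₂ : IsSolution Om lamA lamB eA eB r σ τ betah piF u y0 y₂ μ₂ dy₂ z₂)
    {T : ℝ} (hT : 0 < T) :
    ∀ᵐ t ∂volume.restrict (Ioc 0 T), inDom lamB eB σ (y₁ t) ∧ inDom lamB eB σ (y₂ t) ∧
      ⟪(z₁ t - z₂ t) - (μ₁ t - μ₂ t), y₁ t - y₂ t⟫
        + ‖fracPow lamB eB σ (y₁ t) - fracPow lamB eB σ (y₂ t)‖ ^ 2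
          ≤ Lpi * ‖y₁ t - y₂ t‖ ^ 2 := by
  obtain ⟨hym₁, hd₁, -, -, -, -, -, -, -, -, -, -, hβ₁, -, hv₁, -⟩ := h₁
  obtain ⟨hym₂, hd₂, -, -, -, -, -, -, -, -, -, -, hβ₂, -, hv₂, -⟩ := h₂
  have hsub : Ioc 0 T ⊆ Ioi (0:ℝ) := fun t ht => ht.1
  filter_upwards [ae_restrict_of_ae_restrict_of_subset hsub hd₁,
    ae_restrict_of_ae_restrict_of_subset hsub hd₂,
    ae_restrict_of_ae_restrict_of_subset hsub hv₁,
    ae_restrict_of_ae_restrict_of_subset hsub hv₂,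
    ae_lintegral_comp_lt_top hb (hym₁.mono_set hsub) (hβ₁ T hT),
    ae_lintegral_comp_lt_top hb (hym₂.mono_set hsub) (hβ₂ T hT)] with t hd₁ hd₂ hv₁ hv₂ hf₁ hf₂
  exact ⟨hd₁, hd₂, inner_add_norm_sq_le hpi (hv₁ _ hd₂ hf₂) (hv₂ _ hd₁ hf₁)⟩

end Weak

/-- **Theorem 2.1 (uniqueness of the order parameter).** Under the structural assumptions
and the assumptions on the data, the component `y` of the solution is uniquely determined:
two solutions of the fractional Cahn--Hilliard system with the same data `u`, `y₀`
have the same first component. -/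
theorem uniqueness_of_y
    (Om : Set E3) (lamA lamB : ℕ → ℝ) (eA eB : ℕ → Hs Om) (r σ τ : ℝ)
    (betah : ℝ → ℝ≥0∞) (pih piF : ℝ → ℝ) (Lpi : ℝ≥0)
    (u u' : ℝ → Hs Om) (y0 : Hs Om)
    (hset : SettingHyps Om lamA lamB eA eB r σ τ)
    (hdata : DataHyps Om lamA lamB eB σ betah pih piF Lpi u u' y0)
    (y₁ μ₁ : ℝ → Hs Om) (dy₁ : ℝ → Hs Om →ₗ[ℝ] ℝ) (z₁ : ℝ → Hs Om)
    (y₂ μ₂ : ℝ → Hs Om) (dy₂ : ℝ → Hs Om →ₗ[ℝ] ℝ) (z₂ : ℝ → Hs Om)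
    (h₁ : IsSolution Om lamA lamB eA eB r σ τ betah piF u y0 y₁ μ₁ dy₁ z₁)
    (h₂ : IsSolution Om lamA lamB eA eB r σ τ betah piF u y0 y₂ μ₂ dy₂ z₂) :
    ∀ t : ℝ, 0 ≤ t → y₁ t = y₂ t := by
  obtain ⟨-, -, hbdd, hA0, -, -, -, -, hBtop, hoA, hoB, hspA, hspB, hr, hσ, hτ, -, -⟩ := hset
  obtain ⟨-, hlsc, -, -, hpi, -⟩ := hdata
  have : IsFiniteMeasure (mOm Om) :=
    isFiniteMeasure_restrict.2 hbdd.measure_lt_top.ne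
  obtain ⟨a, rfl⟩ : ∃ a : HilbertBasis ℕ ℝ (Hs Om), ⇑a = eA :=
    ⟨.mk hoA hspA.ge, HilbertBasis.coe_mk hoA hspA.ge⟩
  obtain ⟨b, rfl⟩ : ∃ b : HilbertBasis ℕ ℝ (Hs Om), ⇑b = eB :=
    ⟨.mk hoB hspB.ge, HilbertBasis.coe_mk hoB hspB.ge⟩
  intro t₀ ht₀
  obtain ⟨T, ht₀T⟩ := exists_gt t₀
  have hT : 0 < T := ht₀.trans_lt ht₀T
  have hsub : Ioc 0 T ⊆ Ioi (0:ℝ) := fun t ht => ht.1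
  set y : ℝ → Hs Om := fun t => y₁ t - y₂ t with hy
  set g : ℝ → Hs Om := fun t => (z₁ t - z₂ t) - (μ₁ t - μ₂ t) with hg
  set f : ℕ → ℝ → ℝ := fun j t => dy₁ t (a j) - dy₂ t (a j) with hf
  set w : ℕ → ℝ := fun j => if lamA j = 0 then 1 else τ + ((lamA j ^ r) ^ 2)⁻¹ with hw
  have hw0 : ∀ j, 0 < w j := by
    intro j
    simp only [hw]
    split_ifs with hj
    · exact one_pos
    · have := Real.rpow_pos_of_pos ((hA0 j).lt_of_ne' hj) r
      have := hτ.1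
      positivity
  obtain ⟨hyL₁, hzL₁, hμL₁⟩ := h₁.memLp_two hT
  obtain ⟨hyL₂, hzL₂, hμL₂⟩ := h₂.memLp_two hT
  have hyL : MemLp y 2 (volume.restrict (Ioc 0 T)) := hyL₁.sub hyL₂
  have hgL : MemLp g 2 (volume.restrict (Ioc 0 T)) := (hzL₁.sub hzL₂).sub (hμL₁.sub hμL₂)
  have hy2 : IntegrableOn (fun s => ‖y s‖ ^ 2) (Ioc 0 T) := hyL.norm.integrable_sq
  have hg2 : IntegrableOn (fun s => ‖g s‖ ^ 2) (Ioc 0 T) := hgL.norm.integrable_sq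
  have hfint : ∀ j, ∀ t, 0 < t → IntegrableOn (f j) (Ioc 0 t) := fun j t ht =>
    (h₁.2.2.2.1 _ (inDom_basis lamA a r j) t ht).sub (h₂.2.2.2.1 _ (inDom_basis lamA a r j) t ht)
  have hyf : ∀ j t, 0 ≤ t → ⟪y t, a j⟫ = ∫ s in (0:ℝ)..t, f j s := by
    intro j t ht
    obtain ⟨-, -, -, hi₁, hd₁, -, -, -, -, -, -, -, -, -, -, h0₁⟩ := h₁
    obtain ⟨-, -, -, hi₂, hd₂, -, -, -, -, -, -, -, -, -, -, h0₂⟩ := h₂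
    have hii : ∀ {h : ℝ → ℝ}, (∀ T, 0 < T → IntegrableOn h (Ioc 0 T)) →
        IntervalIntegrable h volume 0 t := fun hh =>
      (intervalIntegrable_iff_integrableOn_Ioc_of_le ht).2
        ((hh (t + 1) (by linarith)).mono_set (Ioc_subset_Ioc_right (by linarith)))
    have hja := inDom_basis lamA a r j
    rw [hy, inner_sub_left, hd₁ _ hja t ht, hd₂ _ hja t ht, h0₁, h0₂,
      intervalIntegral.integral_sub (hii (hi₁ _ hja)) (hii (hi₂ _ hja))]
    ring
  have hfg : ∀ᵐ t ∂volume.restrict (Ioc 0 T), ∀ j,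
      f j t = -((lamA j ^ r) ^ 2 * ⟪μ₁ t - μ₂ t, a j⟫) ∧
        ⟪g t, a j⟫ = τ * f j t - ⟪μ₁ t - μ₂ t, a j⟫ := by
    filter_upwards [ae_restrict_of_ae_restrict_of_subset hsub h₁.ae_dual_apply,
      ae_restrict_of_ae_restrict_of_subset hsub h₂.ae_dual_apply] with t ht₁ ht₂ j
    simp only [hf, hg, inner_sub_left, (ht₁ j).2, (ht₂ j).2]
    refine ⟨?_, by ring⟩
    rw [(ht₁ j).1, (ht₂ j).1]
    ring
  have hker : ∀ j, lamA j = 0 → ∀ t ∈ Icc 0 T, ⟪y t, a j⟫ = 0 := by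
    intro j hj t ht
    rw [hyf j t ht.1, intervalIntegral.integral_of_le ht.1]
    refine integral_eq_zero_of_ae ?_
    filter_upwards [ae_restrict_of_ae_restrict_of_subset (Ioc_subset_Ioc_right ht.2) hfg]
      with s hs
    rw [(hs j).1, hj, Real.zero_rpow hr.ne']
    simp
  have hgf : ∀ j, ∀ᵐ s ∂volume.restrict (Ioc 0 T),
      ⟪g s, a j⟫ * ⟪y s, a j⟫ = w j * (f j s * ⟪y s, a j⟫) := by
    intro j
    filter_upwards [hfg, ae_restrict_mem measurableSet_Ioc] with s hs hsT
    by_cases hj : lamA j = 0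
    · rw [hker j hj s (Ioc_subset_Icc_self hsT)]
      ring
    · have hpos := Real.rpow_pos_of_pos ((hA0 j).lt_of_ne' hj) r
      rw [(hs j).2, (hs j).1]
      simp only [hw, if_neg hj]
      field_simp
      ring
  set φ : ℝ → ℝ := fun t => ∫ s in Ioc 0 t, 2 * ⟪g s, y s⟫ with hφ
  have hsum : ∀ t ∈ Icc 0 T, HasSum (fun j => w j * ⟪y t, a j⟫ ^ 2) (φ t) := by
    intro t ht
    have hst : Ioc 0 t ⊆ Ioc 0 T := Ioc_subset_Ioc_right ht.2
    have := (hasSum_setIntegral_inner a ht.1 (hgL.1.mono_set hst) (hyL.1.mono_set hst)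
      (hg2.mono_set hst) (hy2.mono_set hst)
      (fun j => (hfint j T hT).mono_set hst) (fun j s hs => hyf j s hs.1)
      (fun j => ae_restrict_of_ae_restrict_of_subset hst (hgf j))).mul_left 2
    simp only [hφ, integral_const_mul]
    exact this.congr_fun fun j => by ring
  obtain ⟨C, hC⟩ := exists_norm_sq_le a b hw0 ((_root_.tendsto_rpow_atTop hσ).comp hBtop)
    (ε := 1 / (Lpi + 1)) (by positivity)
  have hle : ∀ᵐ t ∂volume.restrict (Ioc 0 T), 2 * ⟪g t, y t⟫ ≤ 2 * Lpi * C * φ t := by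
    filter_upwards [ae_inner_add_norm_sq_le hpi hlsc h₁ h₂ hT, ae_restrict_mem measurableSet_Ioc]
      with t ⟨hd₁, hd₂, ht⟩ htT
    have hB := hasSum_sq_inner b (fracPow lamB b σ (y₁ t) - fracPow lamB b σ (y₂ t))
    simp only [inner_sub_left, inner_fracPow b hd₁, inner_fracPow b hd₂, ← mul_sub] at hB
    simp only [← inner_sub_left] at hB
    have hn := hC (y t) _ _ (hsum t (Ioc_subset_Icc_self htT)) hB
    have hLn := mul_le_mul_of_nonneg_left hn Lpi.coe_nonneg
    have hL : (Lpi : ℝ) * (1 / (Lpi + 1)) ≤ 1 := by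
      rw [mul_one_div, div_le_one (by positivity)]
      linarith
    have := mul_le_mul_of_nonneg_right hL
      (sq_nonneg ‖fracPow lamB b σ (y₁ t) - fracPow lamB b σ (y₂ t)‖)
    linarith
  have hgy : IntegrableOn (fun t => 2 * ⟪g t, y t⟫) (Ioc 0 T) := by
    refine (hg2.add hy2).mono' ((hgL.1.inner hyL.1).const_mul 2) (Eventually.of_forall fun t => ?_)
    rw [Real.norm_eq_abs, abs_mul, abs_two]
    calc 2 * |⟪g t, y t⟫| ≤ 2 * (‖g t‖ * ‖y t‖) := by gcongr; exact abs_real_inner_le_norm _ _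
      _ = 2 * ‖g t‖ * ‖y t‖ := by ring
      _ ≤ _ := two_mul_le_add_sq _ _
  have hzero := eq_zero_of_primitive_le hgy (fun t _ => rfl)
    (fun t ht => (hsum t ht).nonneg fun j => mul_nonneg (hw0 j).le (sq_nonneg _)) hle t₀ ⟨ht₀, ht₀T⟩
  have hs := hsum t₀ ⟨ht₀, ht₀T.le⟩
  rw [show φ t₀ = 0 from hzero,
    hasSum_zero_iff_of_nonneg fun j => mul_nonneg (hw0 j).le (sq_nonneg _)] at hs
  have hy0 : ‖y t₀‖ ^ 2 = 0 := by
    refine (hasSum_sq_inner a (y t₀)).unique ?_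
    have hz : (fun j => ⟪y t₀, a j⟫ ^ 2) = 0 := by
      ext j
      exact (mul_eq_zero.1 (congr_fun hs j)).resolve_left (hw0 j).ne'
    rw [hz]
    exact hasSum_zero
  exact sub_eq_zero.1 (norm_eq_zero.1 (pow_eq_zero_iff two_ne_zero |>.1 hy0))

end FracCH
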